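/- Let (i,k,ℓ) ∈ X̃_diff with i ≥ 1. If D(i−1,k,ℓ) ≤ 0, then D(i,k,ℓ) = p_k·(i·c_k + b_k) + q_k·D(i−1,k,ℓ) + r_k·min(D(i−1,k+1,ℓ−1), 0), where in the case ℓ = 0 the coefficient r_k is zero and the corresponding term is omitted. -/

import Mathlib

/-- Overall service rate `d(k,ℓ) = k·μ₁ + min(ℓ,C₂)·μ₂`. -/
noncomputable def dRate (C₂ : ℕ) (μ₁ μ₂ : ℝ) (k ℓ : ℕ) : ℝ :=
  (k : ℝ) * μ₁ + ((min ℓ C₂ : ℕ) : ℝ) * μ₂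

/-- Membership of `(i,k,ℓ)` in the state space `X`. -/
def memX (C₁ : ℕ) (i k ℓ : ℕ) : Prop :=
  (i = 0 ∧ k + ℓ < C₁) ∨ k + ℓ = C₁

/-- `v` satisfies the optimality (Bellman) equations of the clearing system.
Terms whose coefficient `k·μ₁` or `min(ℓ,C₂)·μ₂` vanishes contribute `0`,
matching the convention that such summands are omitted. -/
def IsValue (C₁ C₂ : ℕ) (μ₁ μ₂ h₀ h₁ h₂ : ℝ) (v : ℕ → ℕ → ℕ → ℝ) : Prop :=
  v 0 0 0 = 0 ∧
  (∀ k ℓ : ℕ, k + ℓ ≤ C₁ → ¬(k = 0 ∧ ℓ = 0) →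
    v 0 k ℓ = ((k : ℝ) * h₁ + (ℓ : ℝ) * h₂) / dRate C₂ μ₁ μ₂ k ℓ
      + ((k : ℝ) * μ₁ / dRate C₂ μ₁ μ₂ k ℓ) * v 0 (k - 1) ℓ
      + (((min ℓ C₂ : ℕ) : ℝ) * μ₂ / dRate C₂ μ₁ μ₂ k ℓ) * v 0 k (ℓ - 1)) ∧
  (∀ i k ℓ : ℕ, k + ℓ = C₁ →
    v (i + 1) k ℓ =
      (((i : ℝ) + 1) * h₀ + (k : ℝ) * h₁ + (ℓ : ℝ) * h₂) / dRate C₂ μ₁ μ₂ k ℓ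
      + ((k : ℝ) * μ₁ / dRate C₂ μ₁ μ₂ k ℓ) *
          min (v i k ℓ) (v i (k - 1) (ℓ + 1))
      + (((min ℓ C₂ : ℕ) : ℝ) * μ₂ / dRate C₂ μ₁ μ₂ k ℓ) *
          min (v i (k + 1) (ℓ - 1)) (v i k ℓ))

/-- The difference `D(i,k,ℓ) = v(i,k,ℓ) − v(i,k−1,ℓ+1)`. -/
noncomputable def Dv (v : ℕ → ℕ → ℕ → ℝ) (i k ℓ : ℕ) : ℝ :=
  v i k ℓ - v i (k - 1) (ℓ + 1)


/-- `p_k` (with `ℓ = C₁ − k`). -/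
noncomputable def pCoef (C₁ C₂ : ℕ) (μ₁ μ₂ : ℝ) (k ℓ : ℕ) : ℝ :=
  (if ℓ < C₂ then (C₁ : ℝ) else (C₂ : ℝ)) * μ₁ * μ₂ /
    (dRate C₂ μ₁ μ₂ k ℓ * dRate C₂ μ₁ μ₂ (k - 1) (ℓ + 1))

/-- `q_k = (k−1)·μ₁ / d(k−1,ℓ+1)`. -/
noncomputable def qCoef (C₂ : ℕ) (μ₁ μ₂ : ℝ) (k ℓ : ℕ) : ℝ :=
  ((k - 1 : ℕ) : ℝ) * μ₁ / dRate C₂ μ₁ μ₂ (k - 1) (ℓ + 1)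

/-- `r_k = min(ℓ,C₂)·μ₂ / d(k,ℓ)`. -/
noncomputable def rCoef (C₂ : ℕ) (μ₁ μ₂ : ℝ) (k ℓ : ℕ) : ℝ :=
  ((min ℓ C₂ : ℕ) : ℝ) * μ₂ / dRate C₂ μ₁ μ₂ k ℓ

/-- `b_k` : equals `b` if `ℓ < C₂` and `b′` otherwise. -/
noncomputable def bCoef (C₁ C₂ : ℕ) (μ₁ μ₂ h₁ h₂ : ℝ) (ℓ : ℕ) : ℝ :=
  if ℓ < C₂ then h₁ / μ₁ - h₂ / μ₂
  else (h₁ - h₂) / μ₁ - (C₁ : ℝ) * h₂ / ((C₂ : ℝ) * μ₂)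

/-- `c_k` : equals `c` if `ℓ < C₂` and `c′` otherwise. -/
noncomputable def cCoef (C₁ C₂ : ℕ) (μ₁ μ₂ h₀ : ℝ) (ℓ : ℕ) : ℝ :=
  if ℓ < C₂ then h₀ / (C₁ : ℝ) * (1 / μ₁ - 1 / μ₂)
  else -h₀ / ((C₂ : ℝ) * μ₂)

/-- The switching function `x⁺ + min(y,0)`. -/
noncomputable def swF (x y : ℝ) : ℝ := max x 0 + min y 0

lemma swF_lower {x y : ℝ} (h : x ≤ y) : x ≤ swF x y := by
  unfold swF
  rcases max_cases x 0 with h1 | h1 <;> rcases min_cases y 0 with h2 | h2 <;> linarith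

lemma swF_upper {x y : ℝ} (h : x ≤ y) : swF x y ≤ y := by
  unfold swF
  rcases max_cases x 0 with h1 | h1 <;> rcases min_cases y 0 with h2 | h2 <;> linarith

lemma swF_mono {x y x' y' : ℝ} (h : x ≤ x') (h' : y ≤ y') : swF x y ≤ swF x' y' := by
  unfold swF
  exact add_le_add (max_le_max h le_rfl) (min_le_min h' le_rfl)

/-- Abstract monotonicity result for the difference recursion. -/
lemma abstract_mono (N m : ℕ) (hm : 1 ≤ m) (hmN : m < N)
    (E : ℕ → ℕ → ℝ) (p q r : ℕ → ℝ) (b c b' c' : ℝ) (s : ℕ → ℕ → ℝ)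
    (hp : ∀ k < N, 0 ≤ p (k+1)) (hq : ∀ k < N, 0 ≤ q (k+1)) (hr : ∀ k < N, 0 ≤ r (k+1))
    (hsum : ∀ k < N, p (k+1) + q (k+1) + r (k+1) = 1)
    (hrN : r N = 0) (hq1 : q 1 = 0)
    (hs : ∀ i k, m < k → s i k = ((i:ℝ)+1) * c + b)
    (hs' : ∀ i k, k ≤ m → s i k = ((i:ℝ)+1) * c' + b')
    (hE : ∀ i, ∀ k < N, E (i+1) (k+1) = p (k+1) * s i (k+1)
      + r (k+1) * swF (E i (k+1)) (E i (k+2)) + q (k+1) * swF (E i k) (E i (k+1)))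
    (b0 : ∀ k, m < k → k ≤ N → E 0 k = b)
    (b1 : ∀ k, 1 ≤ k → k < N → E 0 k ≤ E 0 (k+1))
    (b2 : ∀ k, 1 ≤ k → k ≤ m → b' ≤ E 0 k)
    (bT : ∀ k < m, p (k+1) * (c' + b') + r (k+1) * E 0 (k+2) + q (k+1) * E 0 (k+1) ≤ E 0 (k+1))
    (hc1 : c ≤ 0 → ∀ k, m < k → k < N → p (k+1) ≤ p k)
    (hc2 : 0 < c → ∀ k, m < k → k < N → p k ≤ p (k+1))
    (hc3 : ∀ k, 1 ≤ k → k < m → p (k+1) ≤ p k)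
    (hc4 : c ≤ 0 → p (m+1) * (-c) ≤ p m * (-c'))
    (hc' : c' ≤ 0) (hcc : c' ≤ c) (hbb : b' ≤ b) :
    ∀ i k, 1 ≤ k → k < N → E i k ≤ E i (k+1) := by
  -- time monotonicity
  have hT : c ≤ 0 → ∀ i, ∀ k < N, E (i+1) (k+1) ≤ E i (k+1) := by
    intro hc i
    induction i with
    | zero =>
      intro k hk
      have e1 : r (k+1) * swF (E 0 (k+1)) (E 0 (k+2)) ≤ r (k+1) * E 0 (k+2) := by
        rcases Nat.lt_or_ge (k+1) N with h | h
        · exact mul_le_mul_of_nonneg_left (swF_upper (b1 _ (by omega) h)) (hr k hk)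
        · have : k + 1 = N := by omega
          rw [this, hrN]; simp
      have e2 : q (k+1) * swF (E 0 k) (E 0 (k+1)) ≤ q (k+1) * E 0 (k+1) := by
        rcases Nat.eq_zero_or_pos k with h | h
        · subst h; simp [hq1]
        · exact mul_le_mul_of_nonneg_left (swF_upper (b1 _ h hk)) (hq k hk)
      rw [hE 0 k hk]
      rcases Nat.lt_or_ge k m with h | h
      · have := bT k h
        rw [hs' 0 (k+1) (by omega)]
        push_cast
        rw [zero_add, one_mul]
        linarith
      · rw [hs 0 (k+1) (by omega)]
        have e3 : r (k+1) * E 0 (k+2) = r (k+1) * b := by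
          rcases Nat.lt_or_ge (k+1) N with h | h
          · rw [b0 (k+2) (by omega) (by omega)]
          · have : k + 1 = N := by omega
            rw [this, hrN]; simp
        rw [b0 (k+1) (by omega) (by omega)] at *
        have := hsum k hk
        have h5 := mul_nonneg (hp k hk) (neg_nonneg.2 hc)
        have h6 : b = p (k+1) * b + q (k+1) * b + r (k+1) * b := by
          rw [← add_mul, ← add_mul, hsum k hk, one_mul]
        push_cast
        linarith
    | succ i ih =>
      intro k hk
      have hA := hE (i+1) k hk
      have hB := hE i k hk
      have e0 : s (i+1) (k+1) ≤ s i (k+1) := by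
        rcases Nat.lt_or_ge k m with h | h
        · rw [hs' _ _ (by omega), hs' _ _ (by omega)]; push_cast; nlinarith
        · rw [hs _ _ (by omega), hs _ _ (by omega)]; push_cast; nlinarith
      have e1 : r (k+1) * swF (E (i+1) (k+1)) (E (i+1) (k+2)) ≤
          r (k+1) * swF (E i (k+1)) (E i (k+2)) := by
        rcases Nat.lt_or_ge (k+1) N with h | h
        · exact mul_le_mul_of_nonneg_left (swF_mono (ih _ hk) (ih _ h)) (hr k hk)
        · have : k + 1 = N := by omega
          rw [this, hrN]; simp
      have e2 : q (k+1) * swF (E (i+1) k) (E (i+1) (k+1)) ≤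
          q (k+1) * swF (E i k) (E i (k+1)) := by
        rcases k with _ | k
        · simp [hq1]
        · exact mul_le_mul_of_nonneg_left (swF_mono (ih _ (by omega)) (ih _ hk)) (hq _ hk)
      have e3 := mul_le_mul_of_nonneg_left e0 (hp k hk)
      linarith
  have hTb : c ≤ 0 → ∀ i k, m ≤ k → k < N → E i (k+1) ≤ b := by
    intro hc i
    induction i with
    | zero => intro k h1 h2; exact (b0 (k+1) (by omega) (by omega)).le
    | succ i ih => intro k h1 h2; exact (hT hc i k h2).trans (ih k h1 h2)
  suffices H : ∀ i : ℕ, (∀ k, 1 ≤ k → k < N → E i k ≤ E i (k+1)) ∧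
      (∀ k, k < m → (i:ℝ) * c' + b' ≤ E i (k+1)) ∧
      (0 < c → ∀ k, m ≤ k → k < N → E i (k+1) ≤ (i:ℝ) * c + b) from fun i => (H i).1
  intro i
  induction i with
  | zero =>
    refine ⟨b1, fun k hk => ?_, fun _ k h1 h2 => ?_⟩
    · simpa using b2 (k+1) (by omega) (by omega)
    · simpa using (b0 (k+1) (by omega) (by omega)).le
  | succ i ih =>
    obtain ⟨hM, hL, hU⟩ := ih
    have hi : (0:ℝ) ≤ i := Nat.cast_nonneg i
    refine ⟨?_, ?_, ?_⟩
    · intro k0 hk1 hkN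
      obtain ⟨k, rfl⟩ : ∃ k, k0 = k + 1 := ⟨k0 - 1, by omega⟩
      have hk : k < N := by omega
      set f := swF (E i (k+1)) (E i (k+2)) with hf
      have hfl : E i (k+1) ≤ f := swF_lower (hM _ hk1 hkN)
      have hfu : f ≤ E i (k+2) := swF_upper (hM _ hk1 hkN)
      have e1 : r (k+2) * f ≤ r (k+2) * swF (E i (k+2)) (E i (k+3)) := by
        rcases Nat.lt_or_ge (k+2) N with h | h
        · exact mul_le_mul_of_nonneg_left (hfu.trans (swF_lower (hM _ (by omega) h))) (hr _ hkN)
        · have : k + 2 = N := by omega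
          rw [this, hrN]; simp
      have e2 : q (k+1) * swF (E i k) (E i (k+1)) ≤ q (k+1) * f := by
        rcases Nat.eq_zero_or_pos k with h | h
        · subst h; simp [hq1]
        · exact mul_le_mul_of_nonneg_left ((swF_upper (hM _ h hk)).trans hfl) (hq k hk)
      have hA := hE i (k+1) hkN
      have hB := hE i k hk
      rw [← hf] at hB
      have hA' : p (k+2) * s i (k+2) + (1 - p (k+2)) * f ≤ E (i+1) (k+2) := by
        have h6 : q (k+2) = 1 - p (k+2) - r (k+2) := by linarith [hsum (k+1) hkN]
        have hA2 : E (i+1) (k+2) = p (k+2) * s i (k+2)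
          + r (k+2) * swF (E i (k+2)) (E i (k+3)) + q (k+2) * f := hA
        rw [hA2, h6]; linarith
      have hB' : E (i+1) (k+1) ≤ p (k+1) * s i (k+1) + (1 - p (k+1)) * f := by
        have h6 : r (k+1) = 1 - p (k+1) - q (k+1) := by linarith [hsum k hk]
        rw [hB, h6]; linarith
      have hp1 := hp k hk
      have hp2 : 0 ≤ p (k+2) := hp (k+1) hkN
      change E (i+1) (k+1) ≤ E (i+1) (k+2)
      suffices h : 0 ≤ p (k+2) * (s i (k+2) - f) + p (k+1) * (f - s i (k+1)) ∨
          E (i+1) (k+1) ≤ E (i+1) (k+2) by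
        rcases h with h | h
        · linarith
        · exact h
      rcases lt_trichotomy (k+1) m with h | h | h
      · left
        rw [hs' _ _ (by omega), hs' _ _ (by omega)]
        have h3 : p (k+2) ≤ p (k+1) := hc3 (k+1) (by omega) h
        have h4 : 0 ≤ f - (((i:ℝ)+1) * c' + b') := by linarith [hL k (by omega)]
        nlinarith [mul_nonneg (sub_nonneg.2 h3) h4]
      · left
        rw [hs _ _ (by omega), hs' _ _ (by omega)]
        have h4 : 0 ≤ f - (((i:ℝ)+1) * c' + b') := by linarith [hL k (by omega)]
        rcases le_or_gt f (((i:ℝ)+1) * c + b) with h5 | h5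
        · exact add_nonneg (mul_nonneg hp2 (by linarith)) (mul_nonneg hp1 h4)
        · rcases le_or_gt c 0 with hc | hc
          · have h6 : f ≤ b := hfu.trans (hTb hc i (k+1) (by omega) hkN)
            have h7 : p (k+2) * (-c) ≤ p (k+1) * (-c') := by
              have := hc4 hc
              rw [← h] at this; exact this
            have h8 : ((i:ℝ)+1) * c' ≤ ((i:ℝ)+1) * c := by nlinarith
            rcases le_or_gt (p (k+2)) (p (k+1)) with h9 | h9
            · have h10 := mul_nonneg (sub_nonneg.2 h9) (sub_nonneg.2 h5.le)
              have h11 := mul_nonneg hp1 (sub_nonneg.2 (add_le_add h8 hbb))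
              linarith
            · have h10 := mul_nonneg (sub_nonneg.2 h9.le) (sub_nonneg.2 h6)
              have h11 := mul_nonneg (by linarith : (0:ℝ) ≤ i + 1) (sub_nonneg.2 h7)
              have h12 := mul_nonneg hp1 (sub_nonneg.2 hbb)
              linarith
          · exfalso
            have := hU hc (k+1) (by omega) hkN
            have h6 : f ≤ (i:ℝ) * c + b := hfu.trans this
            linarith
      · have h' : m < k + 1 := h
        rw [hs _ _ (by omega), hs _ _ (by omega)]
        rw [hs _ _ (by omega)] at hA'
        rcases le_or_gt c 0 with hc | hc
        · have h3 : p (k+2) ≤ p (k+1) := hc1 hc (k+1) h hkN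
          rcases le_or_gt (((i:ℝ)+1) * c + b) f with h5 | h5
          · left
            have h10 := mul_nonneg (sub_nonneg.2 h3) (sub_nonneg.2 h5)
            linarith
          · right
            have h10 := mul_nonneg hp2 (sub_nonneg.2 h5.le)
            have := hT hc i k hk
            linarith
        · left
          have h3 : p (k+1) ≤ p (k+2) := hc2 hc (k+1) h hkN
          have h6 : f ≤ (i:ℝ) * c + b := hfu.trans (hU hc (k+1) (by omega) hkN)
          have h7 : 0 ≤ ((i:ℝ)+1) * c + b - f := by linarith
          have h10 := mul_nonneg (sub_nonneg.2 h3) h7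
          linarith
    · intro k hkm
      have hk : k < N := by omega
      rw [hE i k hk, hs' _ _ (by omega)]
      push_cast
      set y := ((i:ℝ)+1) * c' + b' with hy
      have hy1 : y ≤ (i:ℝ) * c' + b' := by rw [hy]; linarith
      have e1 : r (k+1) * y ≤ r (k+1) * swF (E i (k+1)) (E i (k+2)) :=
        mul_le_mul_of_nonneg_left
          ((hy1.trans (hL k hkm)).trans (swF_lower (hM _ (by omega) (by omega)))) (hr k hk)
      have e2 : q (k+1) * y ≤ q (k+1) * swF (E i k) (E i (k+1)) := by
        rcases k with _ | k
        · simp [hq1]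
        · exact mul_le_mul_of_nonneg_left ((hy1.trans (hL k (by omega))).trans
            (swF_lower (hM _ (by omega) (by omega)))) (hq _ hk)
      have h6 : y = p (k+1) * y + q (k+1) * y + r (k+1) * y := by
        rw [← add_mul, ← add_mul, hsum k hk, one_mul]
      linarith
    · intro hc k hkm hk
      rw [hE i k hk, hs _ _ (by omega)]
      push_cast
      set y := ((i:ℝ)+1) * c + b with hy
      have hy1 : (i:ℝ) * c + b ≤ y := by rw [hy]; linarith
      have e1 : r (k+1) * swF (E i (k+1)) (E i (k+2)) ≤ r (k+1) * y := by
        rcases Nat.lt_or_ge (k+1) N with h | h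
        · exact mul_le_mul_of_nonneg_left ((swF_upper (hM _ (by omega) (by omega))).trans
            ((hU hc (k+1) (by omega) h).trans hy1)) (hr k hk)
        · have : k + 1 = N := by omega
          rw [this, hrN]; simp
      have e2 : q (k+1) * swF (E i k) (E i (k+1)) ≤ q (k+1) * y := 
        mul_le_mul_of_nonneg_left ((swF_upper (hM _ (by omega) (by omega))).trans
            ((hU hc k hkm hk).trans hy1)) (hq k hk)
      have h6 : y = p (k+1) * y + q (k+1) * y + r (k+1) * y := by
        rw [← add_mul, ← add_mul, hsum k hk, one_mul]
      linarith

lemma dRate_pos' {C₂ : ℕ} (hC₂ : 1 ≤ C₂) {μ₁ μ₂ : ℝ} (hμ₁ : 0 < μ₁) (hμ₂ : 0 < μ₂) (k ℓ : ℕ)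
    (h : 1 ≤ k + ℓ) : 0 < dRate C₂ μ₁ μ₂ k ℓ := by
  unfold dRate
  rcases Nat.eq_zero_or_pos k with h0 | h0
  · have : 0 < min ℓ C₂ := by omega
    have : (0:ℝ) < (min ℓ C₂ : ℕ) := by exact_mod_cast this
    positivity
  · have : (0:ℝ) < k := by exact_mod_cast h0
    positivity

/-- One-step recursion for `D` without sign assumptions. -/
lemma Dv_rec
    (C₁ C₂ : ℕ) (hC₂pos : 1 ≤ C₂)
    (μ₁ μ₂ h₀ h₁ h₂ : ℝ)
    (hμ₁ : 0 < μ₁) (hμ₂ : 0 < μ₂)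
    (v : ℕ → ℕ → ℕ → ℝ) (hv : IsValue C₁ C₂ μ₁ μ₂ h₀ h₁ h₂ v)
    (i k ℓ : ℕ) (hkl : k + 1 + ℓ = C₁) :
    Dv v (i + 1) (k + 1) ℓ =
      pCoef C₁ C₂ μ₁ μ₂ (k + 1) ℓ *
          (((i : ℝ) + 1) * cCoef C₁ C₂ μ₁ μ₂ h₀ ℓ + bCoef C₁ C₂ μ₁ μ₂ h₁ h₂ ℓ)
        + rCoef C₂ μ₁ μ₂ (k + 1) ℓ * swF (Dv v i (k + 1) ℓ) (Dv v i (k + 2) (ℓ - 1))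
        + qCoef C₂ μ₁ μ₂ (k + 1) ℓ * swF (Dv v i k (ℓ + 1)) (Dv v i (k + 1) ℓ) := by
  obtain ⟨-, -, h3⟩ := hv
  have hd : 0 < dRate C₂ μ₁ μ₂ (k + 1) ℓ := dRate_pos' hC₂pos hμ₁ hμ₂ _ _ (by omega)
  have hd' : 0 < dRate C₂ μ₁ μ₂ k (ℓ + 1) := dRate_pos' hC₂pos hμ₁ hμ₂ _ _ (by omega)
  have hA := h3 i (k + 1) ℓ hkl
  have hB := h3 i k (ℓ + 1) (by omega)
  have hDk : Dv v (i + 1) (k + 1) ℓ = v (i + 1) (k + 1) ℓ - v (i + 1) k (ℓ + 1) := rfl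
  have m1 : min (v i (k + 1) ℓ) (v i k (ℓ + 1))
      = v i (k + 1) ℓ - max (Dv v i (k + 1) ℓ) 0 := by
    simp only [Dv, Nat.add_sub_cancel]
    rcases le_total (v i (k + 1) ℓ) (v i k (ℓ + 1)) with h | h
    · rw [min_eq_left h, max_eq_right (by linarith)]; ring
    · rw [min_eq_right h, max_eq_left (by linarith)]; ring
  have m2 : min (v i k (ℓ + 1)) (v i (k - 1) (ℓ + 1 + 1))
      = v i k (ℓ + 1) - max (Dv v i k (ℓ + 1)) 0 := by
    simp only [Dv]
    rcases le_total (v i k (ℓ + 1)) (v i (k - 1) (ℓ + 1 + 1)) with h | h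
    · rw [min_eq_left h, max_eq_right (by linarith)]; ring
    · rw [min_eq_right h, max_eq_left (by linarith)]; ring
  have m3 : ((min ℓ C₂ : ℕ) : ℝ) * μ₂ / dRate C₂ μ₁ μ₂ (k + 1) ℓ *
        min (v i (k + 1 + 1) (ℓ - 1)) (v i (k + 1) ℓ)
      = ((min ℓ C₂ : ℕ) : ℝ) * μ₂ / dRate C₂ μ₁ μ₂ (k + 1) ℓ *
        (v i (k + 1) ℓ + min (Dv v i (k + 2) (ℓ - 1)) 0) := by
    rcases ℓ with _ | ℓ
    · simp
    · congr 1
      have : Dv v i (k + 2) (ℓ + 1 - 1) = v i (k + 2) ℓ - v i (k + 1) (ℓ + 1) := rfl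
      rw [this]
      change min (v i (k + 2) ℓ) (v i (k + 1) (ℓ + 1)) = _
      rcases le_total (v i (k + 2) ℓ) (v i (k + 1) (ℓ + 1)) with h | h
      · rw [min_eq_left h, min_eq_left (by linarith)]; ring
      · rw [min_eq_right h, min_eq_right (by linarith)]; ring
  have m4 : min (v i (k + 1) ℓ) (v i k (ℓ + 1))
      = v i k (ℓ + 1) + min (Dv v i (k + 1) ℓ) 0 := by
    simp only [Dv, Nat.add_sub_cancel]
    rcases le_total (v i (k + 1) ℓ) (v i k (ℓ + 1)) with h | h
    · rw [min_eq_left h, min_eq_left (by linarith)]; ring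
    · rw [min_eq_right h, min_eq_right (by linarith)]; ring
  simp only [Nat.add_sub_cancel] at hA hB
  rw [m3, m1] at hA
  rw [m2, m4] at hB
  have m5 : v i (k + 1) ℓ = v i k (ℓ + 1) + max (Dv v i (k + 1) ℓ) 0
      + min (Dv v i (k + 1) ℓ) 0 := by linarith
  rw [m5] at hA
  rw [hDk, hA, hB]
  unfold swF pCoef rCoef qCoef
  simp only [Nat.add_sub_cancel]
  generalize max (Dv v i (k + 1) ℓ) 0 = x₁
  generalize min (Dv v i (k + 1) ℓ) 0 = x₂
  generalize max (Dv v i k (ℓ + 1)) 0 = x₃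
  generalize min (Dv v i (k + 2) (ℓ - 1)) 0 = x₄
  generalize v i k (ℓ + 1) = B
  have hC1p : (0:ℝ) < C₁ := by exact_mod_cast (by omega : 0 < C₁)
  have hC2p : (0:ℝ) < C₂ := by exact_mod_cast (by omega : 0 < C₂)
  have hC1e : (C₁ : ℝ) = k + 1 + ℓ := by rw [← hkl]; push_cast; ring
  unfold bCoef cCoef
  by_cases hl : ℓ < C₂
  · have e1 : dRate C₂ μ₁ μ₂ (k + 1) ℓ = (k + 1) * μ₁ + ℓ * μ₂ := by
      simp [dRate, min_eq_left hl.le]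
    have e2 : dRate C₂ μ₁ μ₂ k (ℓ + 1) = k * μ₁ + (ℓ + 1) * μ₂ := by
      simp [dRate, min_eq_left (show ℓ + 1 ≤ C₂ from hl)]
    rw [e1] at hd ⊢
    rw [e2] at hd' ⊢
    rw [min_eq_left hl.le, min_eq_left (show ℓ + 1 ≤ C₂ from hl)]
    simp only [hl, if_true]
    rw [hC1e] at hC1p ⊢
    push_cast
    field_simp
    ring
  · have e1 : dRate C₂ μ₁ μ₂ (k + 1) ℓ = (k + 1) * μ₁ + C₂ * μ₂ := by
      simp [dRate, min_eq_right (not_lt.1 hl)]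
    have e2 : dRate C₂ μ₁ μ₂ k (ℓ + 1) = k * μ₁ + C₂ * μ₂ := by
      simp [dRate, min_eq_right (show C₂ ≤ ℓ + 1 by omega)]
    rw [e1] at hd ⊢
    rw [e2] at hd' ⊢
    rw [min_eq_right (not_lt.1 hl), min_eq_right (show C₂ ≤ ℓ + 1 by omega)]
    simp only [hl, if_false]
    rw [hC1e] at hC1p ⊢
    push_cast
    field_simp
    ring

/-- Expected holding cost of clearing `ℓ` type-2 jobs. -/
noncomputable def wSum (C₂ : ℕ) (μ₂ h₂ : ℝ) (ℓ : ℕ) : ℝ :=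
  ∑ j ∈ Finset.range ℓ, ((j:ℝ) + 1) * h₂ / (((min (j + 1) C₂ : ℕ) : ℝ) * μ₂)

lemma wSum_succ (C₂ : ℕ) (μ₂ h₂ : ℝ) (ℓ : ℕ) : wSum C₂ μ₂ h₂ (ℓ + 1) =
    wSum C₂ μ₂ h₂ ℓ + ((ℓ:ℝ) + 1) * h₂ / (((min (ℓ + 1) C₂ : ℕ) : ℝ) * μ₂) :=
  Finset.sum_range_succ _ _

/-- Closed form of the boundary values `v(0,k,ℓ)`. -/
lemma v_zero
    (C₁ C₂ : ℕ) (hC₂pos : 1 ≤ C₂)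
    (μ₁ μ₂ h₀ h₁ h₂ : ℝ)
    (hμ₁ : 0 < μ₁) (hμ₂ : 0 < μ₂)
    (v : ℕ → ℕ → ℕ → ℝ) (hv : IsValue C₁ C₂ μ₁ μ₂ h₀ h₁ h₂ v) :
    ∀ n k ℓ : ℕ, k + ℓ = n → n ≤ C₁ → v 0 k ℓ = k * (h₁ / μ₁) +
      wSum C₂ μ₂ h₂ ℓ := by
  obtain ⟨h1, h2, -⟩ := hv
  intro n
  induction n with
  | zero =>
    intro k ℓ h _
    obtain rfl : k = 0 := by omega
    obtain rfl : ℓ = 0 := by omega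
    simp [h1, wSum]
  | succ n ih =>
    intro k ℓ h hn
    have hd : 0 < dRate C₂ μ₁ μ₂ k ℓ := dRate_pos' hC₂pos hμ₁ hμ₂ _ _ (by omega)
    rw [h2 k ℓ (by omega) (by omega)]
    rcases k with _ | k
    · rcases ℓ with _ | ℓ
      · omega
      · have i2 := ih 0 ℓ (by omega) (by omega)
        have hm : (0:ℝ) < (min (ℓ + 1) C₂ : ℕ) := by
          exact_mod_cast (by omega : 0 < min (ℓ + 1) C₂)
        simp only [Nat.add_sub_cancel]
        rw [i2, wSum_succ]
        unfold dRate at hd ⊢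
        generalize ((min (ℓ + 1) C₂ : ℕ) : ℝ) = a at *
        generalize wSum C₂ μ₂ h₂ ℓ = S at *
        push_cast at hd ⊢
        field_simp
        ring
    · have i1 := ih k ℓ (by omega) (by omega)
      rcases ℓ with _ | ℓ
      · simp only [Nat.add_sub_cancel]
        rw [i1]
        unfold dRate at hd ⊢
        simp at hd ⊢
        field_simp
        ring
      · have i2 := ih (k + 1) ℓ (by omega) (by omega)
        have hm : (0:ℝ) < (min (ℓ + 1) C₂ : ℕ) := by
          exact_mod_cast (by omega : 0 < min (ℓ + 1) C₂)
        simp only [Nat.add_sub_cancel]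
        rw [i1, i2, wSum_succ]
        unfold dRate at hd ⊢
        generalize ((min (ℓ + 1) C₂ : ℕ) : ℝ) = a at *
        generalize wSum C₂ μ₂ h₂ ℓ = S at *
        push_cast at hd ⊢
        field_simp
        ring

lemma Dv_zero
    (C₁ C₂ : ℕ) (hC₂pos : 1 ≤ C₂)
    (μ₁ μ₂ h₀ h₁ h₂ : ℝ)
    (hμ₁ : 0 < μ₁) (hμ₂ : 0 < μ₂)
    (v : ℕ → ℕ → ℕ → ℝ) (hv : IsValue C₁ C₂ μ₁ μ₂ h₀ h₁ h₂ v)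
    (k ℓ : ℕ) (hkl : k + 1 + ℓ = C₁) :
    Dv v 0 (k + 1) ℓ = h₁ / μ₁ - ((ℓ:ℝ) + 1) * h₂ / (((min (ℓ + 1) C₂ : ℕ) : ℝ) * μ₂) := by
  have H := v_zero C₁ C₂ hC₂pos μ₁ μ₂ h₀ h₁ h₂ hμ₁ hμ₂ v hv
  have : Dv v 0 (k + 1) ℓ = v 0 (k + 1) ℓ - v 0 k (ℓ + 1) := rfl
  rw [this, H _ (k + 1) ℓ rfl (by omega), H _ k (ℓ + 1) rfl (by omega), wSum_succ]
  push_cast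
  ring

lemma coef_hi (C₁ C₂ : ℕ) (μ₁ μ₂ : ℝ) (k ℓ : ℕ) (hkl : k + 1 + ℓ = C₁) (hl : ℓ < C₂) :
    pCoef C₁ C₂ μ₁ μ₂ (k + 1) ℓ = C₁ * μ₁ * μ₂ /
      (((k + 1) * μ₁ + (C₁ - k - 1) * μ₂) * (k * μ₁ + (C₁ - k) * μ₂)) ∧
    qCoef C₂ μ₁ μ₂ (k + 1) ℓ = k * μ₁ / (k * μ₁ + (C₁ - k) * μ₂) ∧
    rCoef C₂ μ₁ μ₂ (k + 1) ℓ = (C₁ - k - 1) * μ₂ / ((k + 1) * μ₁ + (C₁ - k - 1) * μ₂) := by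
  have hC1e : (C₁ : ℝ) = k + 1 + ℓ := by rw [← hkl]; push_cast; ring
  have h1 : (C₁ : ℝ) - k - 1 = ℓ := by rw [hC1e]; ring
  have h2 : (C₁ : ℝ) - k = ℓ + 1 := by rw [hC1e]; ring
  rw [h1, h2]
  simp [pCoef, qCoef, rCoef, dRate, hl, min_eq_left hl.le,
    min_eq_left (show ℓ + 1 ≤ C₂ from hl)]

lemma coef_lo (C₁ C₂ : ℕ) (μ₁ μ₂ : ℝ) (k ℓ : ℕ) (hl : C₂ ≤ ℓ) :
    pCoef C₁ C₂ μ₁ μ₂ (k + 1) ℓ = C₂ * μ₁ * μ₂ /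
      (((k + 1) * μ₁ + C₂ * μ₂) * (k * μ₁ + C₂ * μ₂)) ∧
    qCoef C₂ μ₁ μ₂ (k + 1) ℓ = k * μ₁ / (k * μ₁ + C₂ * μ₂) ∧
    rCoef C₂ μ₁ μ₂ (k + 1) ℓ = C₂ * μ₂ / ((k + 1) * μ₁ + C₂ * μ₂) := by
  simp [pCoef, qCoef, rCoef, dRate, not_lt.2 hl, min_eq_right hl,
    min_eq_right (show C₂ ≤ ℓ + 1 by omega)]

/-- `D(i,k,C₁-k)` is nondecreasing in `k`. -/
lemma Dv_mono
    (C₁ C₂ : ℕ) (hC₂pos : 1 ≤ C₂) (hC : C₂ < C₁)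
    (μ₁ μ₂ h₀ h₁ h₂ : ℝ)
    (hμ₁ : 0 < μ₁) (hμ₂ : 0 < μ₂)
    (hh₀ : 0 < h₀) (hh₂ : 0 < h₂)
    (v : ℕ → ℕ → ℕ → ℝ) (hv : IsValue C₁ C₂ μ₁ μ₂ h₀ h₁ h₂ v) :
    ∀ i k, 1 ≤ k → k < C₁ → Dv v i k (C₁ - k) ≤ Dv v i (k + 1) (C₁ - (k + 1)) := by
  have hC1p : (0:ℝ) < C₁ := by exact_mod_cast (by omega : 0 < C₁)
  have hC2p : (0:ℝ) < C₂ := by exact_mod_cast (by omega : 0 < C₂)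
  have hCC : (C₂:ℝ) < C₁ := by exact_mod_cast hC
  have Hlo : ∀ k, k + 1 ≤ C₁ - C₂ → _ := fun k hk =>
    coef_lo C₁ C₂ μ₁ μ₂ k (C₁ - (k + 1)) (by omega)
  have Hhi : ∀ k, C₁ - C₂ < k + 1 → k < C₁ → _ := fun k hk hk' =>
    coef_hi C₁ C₂ μ₁ μ₂ k (C₁ - (k + 1)) (by omega) (by omega)
  have Zhi : ∀ k, C₁ - C₂ < k + 1 → k < C₁ →
      Dv v 0 (k + 1) (C₁ - (k + 1)) = h₁ / μ₁ - h₂ / μ₂ := by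
    intro k hk hk'
    rw [Dv_zero C₁ C₂ hC₂pos μ₁ μ₂ h₀ h₁ h₂ hμ₁ hμ₂ v hv k _ (by omega),
      min_eq_left (by omega)]
    push_cast
    have : (0:ℝ) < ((C₁ - (k + 1) : ℕ) : ℝ) + 1 := by positivity
    field_simp
  have Zlo : ∀ k, k ≤ C₁ - C₂ →
      Dv v 0 (k + 1) (C₁ - (k + 1)) = h₁ / μ₁ - (C₁ - k) * h₂ / (C₂ * μ₂) := by
    intro k hk
    rw [Dv_zero C₁ C₂ hC₂pos μ₁ μ₂ h₀ h₁ h₂ hμ₁ hμ₂ v hv k _ (by omega),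
      min_eq_right (by omega), Nat.cast_sub (by omega)]
    push_cast
    ring
  have rpos : ∀ k : ℕ, k < C₁ → (0:ℝ) ≤ C₁ - k - 1 := by
    intro k hk
    have : ((k + 1 : ℕ) : ℝ) ≤ C₁ := by exact_mod_cast hk
    push_cast at this; linarith
  have csgn : h₀ / (C₁:ℝ) * (1 / μ₁ - 1 / μ₂) = h₀ * (μ₂ - μ₁) / (C₁ * μ₁ * μ₂) := by
    field_simp
  refine abstract_mono C₁ (C₁ - C₂) (by omega) (by omega)
    (fun i k => Dv v i k (C₁ - k))
    (fun k => pCoef C₁ C₂ μ₁ μ₂ k (C₁ - k))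
    (fun k => qCoef C₂ μ₁ μ₂ k (C₁ - k))
    (fun k => rCoef C₂ μ₁ μ₂ k (C₁ - k))
    (h₁ / μ₁ - h₂ / μ₂) (h₀ / (C₁ : ℝ) * (1 / μ₁ - 1 / μ₂))
    ((h₁ - h₂) / μ₁ - (C₁ : ℝ) * h₂ / ((C₂ : ℝ) * μ₂)) (-h₀ / ((C₂ : ℝ) * μ₂))
    (fun i k => ((i:ℝ) + 1) * cCoef C₁ C₂ μ₁ μ₂ h₀ (C₁ - k)
      + bCoef C₁ C₂ μ₁ μ₂ h₁ h₂ (C₁ - k))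
    ?hp ?hq ?hr ?hsum ?hrN ?hq1 ?hs ?hs' ?hE ?b0 ?b1 ?b2 ?bT ?hc1 ?hc2 ?hc3 ?hc4 ?hc' ?hcc ?hbb
  case hp =>
    intro k hk
    have := dRate_pos' hC₂pos hμ₁ hμ₂ (k + 1) (C₁ - (k + 1)) (by omega)
    have := dRate_pos' hC₂pos hμ₁ hμ₂ k (C₁ - (k + 1) + 1) (by omega)
    simp only [pCoef, Nat.add_sub_cancel]
    split_ifs <;> positivity
  case hq =>
    intro k hk
    have := dRate_pos' hC₂pos hμ₁ hμ₂ k (C₁ - (k + 1) + 1) (by omega)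
    simp only [qCoef, Nat.add_sub_cancel]
    positivity
  case hr =>
    intro k hk
    have := dRate_pos' hC₂pos hμ₁ hμ₂ (k + 1) (C₁ - (k + 1)) (by omega)
    simp only [rCoef]
    positivity
  case hsum =>
    intro k hk
    rcases Nat.lt_or_ge (C₁ - C₂) (k + 1) with h | h
    · obtain ⟨e1, e2, e3⟩ := Hhi k h hk
      simp only [e1, e2, e3]
      have h1 := rpos k hk
      have h2 : 0 < (C₁:ℝ) - k := by linarith
      have h3 : 0 < ((k:ℝ) + 1) * μ₁ + (C₁ - k - 1) * μ₂ := by positivity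
      have h4 : 0 < (k:ℝ) * μ₁ + (C₁ - k) * μ₂ := by positivity
      field_simp
      ring
    · obtain ⟨e1, e2, e3⟩ := Hlo k h
      simp only [e1, e2, e3]
      field_simp
      ring
  case hrN => simp [rCoef]
  case hq1 => simp [qCoef]
  case hs =>
    intro i k hk
    simp only [cCoef, bCoef, if_pos (show C₁ - k < C₂ by omega)]
  case hs' =>
    intro i k hk
    simp only [cCoef, bCoef, if_neg (show ¬ C₁ - k < C₂ by omega)]
  case hE =>
    intro i k hk
    have := Dv_rec C₁ C₂ hC₂pos μ₁ μ₂ h₀ h₁ h₂ hμ₁ hμ₂ v hv i k (C₁ - (k + 1)) (by omega)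
    rw [show C₁ - (k + 1) - 1 = C₁ - (k + 2) by omega,
      show C₁ - (k + 1) + 1 = C₁ - k by omega] at this
    exact this
  case b0 =>
    intro k hk hk'
    obtain ⟨k, rfl⟩ : ∃ j, k = j + 1 := ⟨k - 1, by omega⟩
    exact Zhi k hk hk'
  case b1 =>
    intro k hk hk'
    obtain ⟨k, rfl⟩ : ∃ j, k = j + 1 := ⟨k - 1, by omega⟩
    rcases Nat.lt_or_ge (C₁ - C₂) (k + 1) with h | h
    · rw [Zhi k h (by omega), Zhi (k + 1) (by omega) hk']
    · rw [Zlo k (by omega), Zlo (k + 1) h]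
      push_cast
      gcongr
      linarith
  case b2 =>
    intro k hk hk'
    obtain ⟨k, rfl⟩ : ∃ j, k = j + 1 := ⟨k - 1, by omega⟩
    rw [Zlo k (by omega), sub_div]
    have e1 : ((C₁:ℝ) - k) * h₂ / (C₂ * μ₂) ≤ C₁ * h₂ / (C₂ * μ₂) := by
      gcongr
      linarith [(Nat.cast_nonneg k : (0:ℝ) ≤ k)]
    have e2 : 0 < h₂ / μ₁ := by positivity
    linarith
  case bT =>
    intro k hk
    obtain ⟨e1, e2, e3⟩ := Hlo k hk
    rw [e1, e2, e3, Zlo k (by omega), Zlo (k + 1) hk]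
    push_cast
    rw [← sub_nonneg]
    have : 0 ≤ μ₁ * h₀ / (((k + 1) * μ₁ + C₂ * μ₂) * (k * μ₁ + C₂ * μ₂)) := by positivity
    refine this.trans_eq ?_
    field_simp
    ring
  case hc1 =>
    intro hc k hk hk'
    obtain ⟨k, rfl⟩ : ∃ j, k = j + 1 := ⟨k - 1, by omega⟩
    have hμ : μ₂ ≤ μ₁ := by
      by_contra hcon
      rw [csgn] at hc
      have : 0 < h₀ * (μ₂ - μ₁) / (C₁ * μ₁ * μ₂) :=
        div_pos (mul_pos hh₀ (by linarith)) (by positivity)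
      linarith
    rw [(Hhi k hk (by omega)).1, (Hhi (k + 1) (by omega) hk').1]
    have h1 := rpos (k + 1) hk'
    push_cast at h1 ⊢
    have h2 : 0 < (C₁:ℝ) - k - 1 := by linarith
    have h3 : 0 < (C₁:ℝ) - k := by linarith
    have h2' : 0 < (C₁:ℝ) - (k + 1) := by linarith
    apply div_le_div_of_nonneg_left (by positivity) (by positivity)
    rw [mul_comm, show (C₁:ℝ) - (k + 1) = C₁ - k - 1 by ring]
    have : 0 ≤ ((k:ℝ) + 1) * μ₁ + (C₁ - k - 1) * μ₂ := by positivity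
    rw [mul_comm, mul_comm (((k:ℝ) + 1) * μ₁ + (C₁ - k - 1) * μ₂)]
    apply mul_le_mul_of_nonneg_right _ this
    linarith
  case hc2 =>
    intro hc k hk hk'
    obtain ⟨k, rfl⟩ : ∃ j, k = j + 1 := ⟨k - 1, by omega⟩
    have hμ : μ₁ ≤ μ₂ := by
      by_contra hcon
      rw [csgn] at hc
      have : h₀ * (μ₂ - μ₁) / (C₁ * μ₁ * μ₂) < 0 :=
        div_neg_of_neg_of_pos (mul_neg_of_pos_of_neg hh₀ (by linarith)) (by positivity)
      linarith
    rw [(Hhi k hk (by omega)).1, (Hhi (k + 1) (by omega) hk').1]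
    have h1 := rpos (k + 1) hk'
    push_cast at h1 ⊢
    have h2 : 0 < (C₁:ℝ) - k - 1 := by linarith
    have h3 : 0 < (C₁:ℝ) - k := by linarith
    have h2' : 0 < (C₁:ℝ) - (k + 1) := by linarith
    apply div_le_div_of_nonneg_left (by positivity) (by positivity)
    rw [show (C₁:ℝ) - (k + 1) = C₁ - k - 1 by ring]
    have : 0 ≤ ((k:ℝ) + 1) * μ₁ + (C₁ - k - 1) * μ₂ := by positivity
    rw [mul_comm (((k:ℝ) + 1) * μ₁ + (C₁ - k - 1) * μ₂)]
    apply mul_le_mul_of_nonneg_right _ this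
    linarith
  case hc3 =>
    intro k hk hk'
    obtain ⟨k, rfl⟩ : ∃ j, k = j + 1 := ⟨k - 1, by omega⟩
    rw [(Hlo k (by omega)).1, (Hlo (k + 1) (by omega)).1]
    push_cast
    apply div_le_div_of_nonneg_left (by positivity) (by positivity)
    gcongr <;> linarith
  case hc4 =>
    intro hc
    obtain ⟨k, hk⟩ : ∃ j, C₁ - C₂ = j + 1 := ⟨C₁ - C₂ - 1, by omega⟩
    have hμ : μ₂ ≤ μ₁ := by
      by_contra hcon
      rw [csgn] at hc
      have : 0 < h₀ * (μ₂ - μ₁) / (C₁ * μ₁ * μ₂) :=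
        div_pos (mul_pos hh₀ (by linarith)) (by positivity)
      linarith
    rw [hk, (Hlo k (by omega)).1, (Hhi (k + 1) (by omega) (by omega)).1, csgn]
    have hCe : (C₁:ℝ) = C₂ + k + 1 := by
      have : C₁ = C₂ + k + 1 := by omega
      rw [this]; push_cast; ring
    have h1 : (1:ℝ) ≤ C₂ := by exact_mod_cast hC₂pos
    push_cast
    have x1 : (C₁:ℝ) - (k + 1) - 1 = C₂ - 1 := by rw [hCe]; ring
    have x2 : (C₁:ℝ) - (k + 1) = C₂ := by rw [hCe]; ring
    rw [x1, x2]
    have g1 : 0 < ((k:ℝ) + 1 + 1) * μ₁ + (C₂ - 1) * μ₂ := by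
      have : 0 ≤ (C₂:ℝ) - 1 := by linarith
      positivity
    have g2 : 0 < ((k:ℝ) + 1) * μ₁ + C₂ * μ₂ := by positivity
    have g3 : 0 < (k:ℝ) * μ₁ + C₂ * μ₂ := by positivity
    have t1 : (C₁:ℝ) * μ₁ * μ₂ / ((((k:ℝ) + 1 + 1) * μ₁ + (C₂ - 1) * μ₂) *
        (((k:ℝ) + 1) * μ₁ + C₂ * μ₂)) * -(h₀ * (μ₂ - μ₁) / (C₁ * μ₁ * μ₂)) =
        h₀ * (μ₁ - μ₂) / ((((k:ℝ) + 1 + 1) * μ₁ + (C₂ - 1) * μ₂) *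
        (((k:ℝ) + 1) * μ₁ + C₂ * μ₂)) := by
      field_simp
      ring
    have t2 : (C₂:ℝ) * μ₁ * μ₂ / ((((k:ℝ) + 1) * μ₁ + C₂ * μ₂) * ((k:ℝ) * μ₁ + C₂ * μ₂)) *
        -(-h₀ / (C₂ * μ₂)) =
        h₀ * μ₁ / (((k:ℝ) * μ₁ + C₂ * μ₂) * (((k:ℝ) + 1) * μ₁ + C₂ * μ₂)) := by
      field_simp
    rw [t1, t2]
    apply div_le_div₀ (by positivity) _ (by positivity) _
    · exact mul_le_mul_of_nonneg_left (by linarith) hh₀.le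
    · apply mul_le_mul_of_nonneg_right _ g2.le
      linarith
  case hc' =>
    rw [neg_div]
    have : 0 < h₀ / (C₂ * μ₂) := by positivity
    linarith
  case hcc =>
    have e1 : h₀ / (C₁ * μ₂) ≤ h₀ / (C₂ * μ₂) := by gcongr
    have e2 : h₀ / (C₁:ℝ) * (1 / μ₁ - 1 / μ₂) = h₀ / (C₁ * μ₁) - h₀ / (C₁ * μ₂) := by
      field_simp
    have e3 : 0 < h₀ / (C₁ * μ₁) := by positivity
    rw [e2, neg_div]
    linarith
  case hbb =>
    have e1 : h₂ / μ₂ ≤ C₁ * h₂ / (C₂ * μ₂) := by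
      rw [div_le_div_iff₀ (by positivity) (by positivity)]
      nlinarith [mul_pos hh₂ hμ₂]
    have e2 : 0 < h₂ / μ₁ := by positivity
    rw [sub_div]
    linarith

theorem stmt13
    (C₁ C₂ : ℕ) (hC₂pos : 1 ≤ C₂) (hC : C₂ < C₁)
    (μ₁ μ₂ h₀ h₁ h₂ : ℝ)
    (hμ₁ : 0 < μ₁) (hμ₂ : 0 < μ₂)
    (hh₀ : 0 < h₀) (hh₁ : 0 < h₁) (hh₂ : 0 < h₂)
    (v : ℕ → ℕ → ℕ → ℝ) (hv : IsValue C₁ C₂ μ₁ μ₂ h₀ h₁ h₂ v)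
    (i k ℓ : ℕ) (hkl : k + ℓ = C₁) (hk : 1 ≤ k)
    (hD : Dv v i k ℓ ≤ 0) :
    Dv v (i + 1) k ℓ =
      pCoef C₁ C₂ μ₁ μ₂ k ℓ *
          (((i : ℝ) + 1) * cCoef C₁ C₂ μ₁ μ₂ h₀ ℓ + bCoef C₁ C₂ μ₁ μ₂ h₁ h₂ ℓ)
        + qCoef C₂ μ₁ μ₂ k ℓ * Dv v i k ℓ
        + rCoef C₂ μ₁ μ₂ k ℓ * min (Dv v i (k + 1) (ℓ - 1)) 0 := by
  obtain ⟨k, rfl⟩ : ∃ j, k = j + 1 := ⟨k - 1, by omega⟩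
  rw [Dv_rec C₁ C₂ hC₂pos μ₁ μ₂ h₀ h₁ h₂ hμ₁ hμ₂ v hv i k ℓ hkl]
  have e1 : swF (Dv v i (k + 1) ℓ) (Dv v i (k + 2) (ℓ - 1))
      = min (Dv v i (k + 1 + 1) (ℓ - 1)) 0 := by
    rw [swF, max_eq_right hD, zero_add]
  have e2 : qCoef C₂ μ₁ μ₂ (k + 1) ℓ * swF (Dv v i k (ℓ + 1)) (Dv v i (k + 1) ℓ)
      = qCoef C₂ μ₁ μ₂ (k + 1) ℓ * Dv v i (k + 1) ℓ := by
    rcases Nat.eq_zero_or_pos k with h | h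
    · subst h; simp [qCoef]
    · have hm := Dv_mono C₁ C₂ hC₂pos hC μ₁ μ₂ h₀ h₁ h₂ hμ₁ hμ₂ hh₀ hh₂ v hv i k h (by omega)
      rw [show C₁ - k = ℓ + 1 by omega, show C₁ - (k + 1) = ℓ by omega] at hm
      rw [swF, max_eq_right (hm.trans hD), min_eq_left hD, zero_add]
  rw [e1, e2]
  ring
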